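/- arXiv:math/0504361 — 3 statements merged into one kernel-verified Lean document; each statement's English description precedes it below -/
import Mathlib

section
/- The number of noncrossing linked partitions of {1,...,n+1} equals the large Schröder number r_n. -/
attribute [local instance] Classical.propDecidable

noncomputable section

/-- Two subsets `E`, `F` of `{1,...,n}` are crossing if there exist
`i₁ < j₁ < i₂ < j₂` with `i₁, i₂ ∈ E` and `j₁, j₂ ∈ F`. -/
def Crossing (E F : Finset ℕ) : Prop :=
  ∃ i₁ ∈ E, ∃ i₂ ∈ E, ∃ j₁ ∈ F, ∃ j₂ ∈ F, i₁ < j₁ ∧ j₁ < i₂ ∧ i₂ < j₂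

/-- `i` is the minimum element of `E`. -/
def IsMinOf (i : ℕ) (E : Finset ℕ) : Prop := i ∈ E ∧ ∀ j ∈ E, i ≤ j

/-- `E` and `F` are nearly disjoint. -/
def NearlyDisjoint (E F : Finset ℕ) : Prop :=
  ∀ i ∈ E ∩ F,
    (IsMinOf i E ∧ 1 < E.card ∧ ¬ IsMinOf i F) ∨
    (¬ IsMinOf i E ∧ IsMinOf i F ∧ 1 < F.card)

/-- `π` is a noncrossing linked partition of `{1,...,n}`. -/
def IsNCL (n : ℕ) (π : Finset (Finset ℕ)) : Prop :=
  (∀ E ∈ π, E.Nonempty) ∧ π.biUnion id = Finset.Icc 1 n ∧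
    ∀ E ∈ π, ∀ F ∈ π, E ≠ F → ¬ Crossing E F ∧ NearlyDisjoint E F

/-- `π` is a noncrossing partition of `{1,...,n}`. -/
def IsNC (n : ℕ) (π : Finset (Finset ℕ)) : Prop :=
  (∀ E ∈ π, E.Nonempty) ∧ π.biUnion id = Finset.Icc 1 n ∧
    ∀ E ∈ π, ∀ F ∈ π, E ≠ F → Disjoint E F ∧ ¬ Crossing E F

/-- The order on (linked) partitions: every block of `π` is contained in a block of `σ`. -/
def NCLle (π σ : Finset (Finset ℕ)) : Prop := ∀ E ∈ π, ∃ E' ∈ σ, E ⊆ E'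

/-- The finset of all noncrossing linked partitions of `{1,...,n}`. -/
def NCLset (n : ℕ) : Finset (Finset (Finset ℕ)) :=
  ((Finset.Icc 1 n).powerset.powerset).filter (IsNCL n)

/-- The finset of all noncrossing partitions of `{1,...,n}`. -/
def NCset (n : ℕ) : Finset (Finset (Finset ℕ)) :=
  ((Finset.Icc 1 n).powerset.powerset).filter (IsNC n)

/-- The large Schröder numbers, via the standard Schröder recurrence
`r₀ = 1`, `rₙ₊₁ = rₙ + ∑_{k=0}^{n} r_k r_{n-k}`, equivalent to the
generating function `∑ rₙ wⁿ = (1 - w - √(1 - 6w + w²))/(2w)`. -/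
def schroder : ℕ → ℕ
  | 0 => 1
  | n + 1 =>
      schroder n + ∑ k ∈ (Finset.range (n + 1)).attach,
        schroder k.1 * schroder (n - k.1)
termination_by n => n
decreasing_by
  all_goals first
    | exact Nat.lt_succ_self n
    | (have hk := k.2; simp only [Finset.mem_range] at hk; omega)


/-- Noncrossing parent functions on `{1,...,m}` (value `0` means no parent). -/
def PF (m : ℕ) (f : ℕ → ℕ) : Prop :=
  (∀ j, f j ≠ 0 → f j < j ∧ j ≤ m) ∧
    ∀ c d, c < d → f c ≠ 0 → f c < f d → f d < c → False

/-- Visible vertices. -/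
def vis (m : ℕ) (f : ℕ → ℕ) : Finset ℕ :=
  (Finset.Icc 1 m).filter (fun b => ∀ c ∈ Finset.Icc 1 m, f c ≠ 0 → f c < b → b < c → False)

/-- The counting function of the generating tree. -/
def gt : ℕ → ℕ → ℕ
  | 0, _ => 1
  | t + 1, k => gt t (k + 1) + ∑ i ∈ Finset.range k, gt t (i + 2)

/-- All extensions by `t` further vertices. -/
def extn : ℕ → ℕ → (ℕ → ℕ) → Finset (ℕ → ℕ)
  | 0, _, f => {f}
  | t + 1, m, f =>
      (insert 0 (vis m f)).biUnion (fun b => extn t (m + 1) (Function.update f (m + 1) b))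

theorem PF_step {m : ℕ} {f : ℕ → ℕ} (hf : PF m f) {b : ℕ} (hb : b ∈ insert 0 (vis m f)) :
    PF (m + 1) (Function.update f (m + 1) b) := by
  obtain ⟨h1, h2⟩ := hf
  simp only [vis, Finset.mem_insert, Finset.mem_filter, Finset.mem_Icc] at hb
  refine ⟨?_, ?_⟩
  · intro j hj
    have := h1 j
    simp only [Function.update_apply] at hj ⊢
    split_ifs at * <;> omega
  · intro c d hcd hc hcd' hdc
    have h3 := h1 c
    have h4 := h1 d
    simp only [Function.update_apply] at hc hcd' hdc
    have hcm : c ≠ m + 1 := by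
      intro hce
      have hd : d ≠ m + 1 := by omega
      rw [if_neg hd] at hcd' hdc
      omega
    rw [if_neg hcm] at hc hcd'
    split_ifs at hcd' hdc with hd
    · rcases hb with rfl | hb
      · omega
      · exact hb.2 c ⟨by omega, by omega⟩ hc hcd' hdc
    · exact h2 c d hcd hc hcd' hdc

theorem mem_extn (t : ℕ) : ∀ (m : ℕ) (f : ℕ → ℕ), PF m f → ∀ g,
    g ∈ extn t m f ↔ PF (m + t) g ∧ ∀ j ≤ m, g j = f j := by
  induction t with
  | zero =>
    intro m f hf g
    simp only [extn, Finset.mem_singleton, add_zero]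
    constructor
    · rintro rfl
      exact ⟨hf, fun _ _ => rfl⟩
    · rintro ⟨hg, h⟩
      funext j
      by_cases hj : j ≤ m
      · exact h j hj
      · have h1 := hf.1 j
        have h2 := hg.1 j
        omega
  | succ t ih =>
    intro m f hf g
    simp only [extn, Finset.mem_biUnion]
    constructor
    · rintro ⟨b, hb, hg⟩
      rw [ih _ _ (PF_step hf hb)] at hg
      refine ⟨by rw [show m + (t + 1) = m + 1 + t by omega]; exact hg.1, fun j hj => ?_⟩
      rw [hg.2 j (by omega), Function.update_of_ne (by omega)]
    · rintro ⟨hg, h⟩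
      have hb : g (m + 1) ∈ insert 0 (vis m f) := by
        simp only [vis, Finset.mem_insert, Finset.mem_filter, Finset.mem_Icc]
        by_cases h0 : g (m + 1) = 0
        · exact Or.inl h0
        · right
          have := hg.1 _ h0
          refine ⟨by omega, fun c hc hc0 hlt hlt' => ?_⟩
          rw [← h c hc.2] at hc0 hlt
          exact hg.2 c (m + 1) (by omega) hc0 hlt hlt'
      refine ⟨g (m + 1), hb, ?_⟩
      rw [ih _ _ (PF_step hf hb)]
      refine ⟨by rw [show m + 1 + t = m + (t + 1) by omega]; exact hg, fun j hj => ?_⟩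
      by_cases hj' : j = m + 1
      · subst hj'; simp
      · rw [Function.update_of_ne hj']; exact h j (by omega)

theorem vis_zero {m : ℕ} {f : ℕ → ℕ} (hf : PF m f) :
    (vis (m + 1) (Function.update f (m + 1) 0)).card = (vis m f).card + 1 := by
  have : vis (m + 1) (Function.update f (m + 1) 0) = insert (m + 1) (vis m f) := by
    ext b
    simp only [vis, Finset.mem_insert, Finset.mem_filter, Finset.mem_Icc]
    constructor
    · rintro ⟨hb, h⟩
      by_cases hb' : b = m + 1
      · exact Or.inl hb'
      · refine Or.inr ⟨by omega, fun c hc => ?_⟩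
        have := h c (by omega)
        rwa [Function.update_of_ne (by omega)] at this
    · rintro (rfl | ⟨hb, h⟩)
      · exact ⟨by omega, fun c hc _ _ _ => by omega⟩
      · refine ⟨by omega, fun c hc => ?_⟩
        by_cases hc' : c = m + 1
        · subst hc'; simp
        · rw [Function.update_of_ne hc']
          exact h c (by omega)
  rw [this, Finset.card_insert_of_notMem]
  simp [vis]

theorem vis_pos {m : ℕ} {f : ℕ → ℕ} (hf : PF m f) {b : ℕ} (hb : b ∈ vis m f) :
    (vis (m + 1) (Function.update f (m + 1) b)).card
      = ((vis m f).filter (fun v => v ≤ b)).card + 1 := by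
  have : vis (m + 1) (Function.update f (m + 1) b)
      = insert (m + 1) ((vis m f).filter (fun v => v ≤ b)) := by
    simp only [vis, Finset.mem_filter, Finset.mem_Icc] at hb
    ext v
    simp only [vis, Finset.mem_insert, Finset.mem_filter, Finset.mem_Icc]
    constructor
    · rintro ⟨hv, h⟩
      by_cases hv' : v = m + 1
      · exact Or.inl hv'
      · refine Or.inr ⟨⟨by omega, fun c hc => ?_⟩, ?_⟩
        · have := h c (by omega)
          rwa [Function.update_of_ne (by omega)] at this
        · have := h (m + 1) (by omega)
          simp only [Function.update_self] at this
          by_contra hlt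
          exact this (by omega) (by omega) (by omega)
    · rintro (rfl | ⟨⟨hv, h⟩, hvb⟩)
      · exact ⟨by omega, fun c hc _ _ _ => by omega⟩
      · refine ⟨by omega, fun c hc => ?_⟩
        by_cases hc' : c = m + 1
        · subst hc'; simp only [Function.update_self]; omega
        · rw [Function.update_of_ne hc']
          exact h c (by omega)
  rw [this, Finset.card_insert_of_notMem]
  simp [vis]

theorem sum_rank (φ : ℕ → ℕ) (V : Finset ℕ) :
    ∑ b ∈ V, φ ((V.filter (fun v => v ≤ b)).card) = ∑ i ∈ Finset.range V.card, φ (i + 1) := by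
  induction V using Finset.induction_on_max with
  | empty => simp
  | insert a s hs ih =>
    have ha : a ∉ s := fun h => lt_irrefl _ (hs a h)
    rw [Finset.sum_insert ha, Finset.card_insert_of_notMem ha, Finset.sum_range_succ, ← ih, add_comm]
    congr 1
    · refine Finset.sum_congr rfl fun b hb => ?_
      congr 2
      rw [Finset.filter_insert, if_neg (by have := hs b hb; omega)]
    · congr 1
      rw [Finset.filter_true_of_mem, Finset.card_insert_of_notMem ha]
      intro x hx
      rcases Finset.mem_insert.1 hx with rfl | hx
      · exact le_rfl
      · exact (hs x hx).le

theorem card_extn (t : ℕ) : ∀ (m : ℕ) (f : ℕ → ℕ), PF m f →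
    (extn t m f).card = gt t (vis m f).card := by
  induction t with
  | zero => intro m f _; simp [extn, gt]
  | succ t ih =>
    intro m f hf
    rw [extn, Finset.card_biUnion]
    · rw [Finset.sum_congr rfl (fun b hb => ih _ _ (PF_step hf hb)),
        Finset.sum_insert (by simp [vis]), vis_zero hf,
        Finset.sum_congr rfl (fun b hb => by rw [vis_pos hf hb]),
        sum_rank (fun i => gt t (i + 1)), gt]
    · intro b hb b' hb' hne
      refine Finset.disjoint_left.2 ?_
      intro g hg hg'
      rw [Finset.mem_coe] at hb hb'
      dsimp only at hg hg'
      rw [mem_extn _ _ _ (PF_step hf hb)] at hg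
      rw [mem_extn _ _ _ (PF_step hf hb')] at hg'
      have h1 := hg.2 (m + 1) le_rfl
      have h2 := hg'.2 (m + 1) le_rfl
      simp only [Function.update_self] at h1 h2
      exact hne (h1.symm.trans h2)

theorem schroder_step (n : ℕ) : schroder (n + 1) =
    schroder n + ∑ k ∈ Finset.range (n + 1), schroder k * schroder (n - k) := by
  rw [schroder, Finset.sum_attach (Finset.range (n + 1)) (fun k => schroder k * schroder (n - k))]

/-- Generating function of the Schröder numbers. -/
def RR : PowerSeries ℚ := PowerSeries.mk (fun n => (schroder n : ℚ))

/-- Generating function of the little Schröder numbers. -/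
def SS : PowerSeries ℚ := PowerSeries.C (1 / 2 : ℚ) * (1 + RR)

theorem RR_eq : RR = 1 + PowerSeries.X * (RR + RR * RR) := by
  ext n
  cases n with
  | zero => simp [RR, schroder]
  | succ n =>
    rw [map_add, PowerSeries.coeff_succ_X_mul, map_add, PowerSeries.coeff_mul,
      Finset.Nat.sum_antidiagonal_eq_sum_range_succ_mk]
    simp [RR, schroder_step, PowerSeries.coeff_one]

theorem two_SS : 2 * SS = 1 + RR := by
  have : (2 : PowerSeries ℚ) = PowerSeries.C (2 : ℚ) := (map_ofNat _ 2).symm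
  rw [SS, this, ← mul_assoc, ← map_mul]
  norm_num

theorem SS_eq : SS = 1 + PowerSeries.X * RR * SS := by
  have h2 : (2 : PowerSeries ℚ) ≠ 0 := by
    intro h
    have h' := congrArg (PowerSeries.constantCoeff (R := ℚ)) h
    rw [map_ofNat, map_zero] at h'
    norm_num at h'
  apply mul_left_cancel₀ h2
  linear_combination (1 - PowerSeries.X * RR) * two_SS + RR_eq

theorem key (k : ℕ) : RR * SS ^ k = 1 + PowerSeries.X *
    (RR * SS ^ (k + 1) + ∑ i ∈ Finset.range (k + 1), RR * SS ^ (i + 1)) := by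
  induction k with
  | zero =>
    simp only [zero_add, Finset.sum_range_one]
    linear_combination RR_eq - PowerSeries.X * RR * two_SS
  | succ k ih =>
    rw [Finset.sum_range_succ]
    linear_combination ih + RR * SS ^ k * SS_eq - PowerSeries.X * RR * SS ^ (k + 1) * two_SS

theorem gt_eq (t : ℕ) : ∀ k, (gt t (k + 1) : ℚ) = PowerSeries.coeff t (RR * SS ^ k) := by
  induction t with
  | zero =>
    intro k
    rw [key]
    simp [gt]
  | succ t ih =>
    intro k
    rw [key, map_add, PowerSeries.coeff_succ_X_mul, map_add, map_sum, gt]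
    push_cast
    rw [ih, Finset.sum_congr rfl (fun i _ => ih (i + 1))]
    simp [PowerSeries.coeff_one]

theorem gt_schroder (n : ℕ) : gt n 1 = schroder n := by
  have := gt_eq n 0
  simp only [zero_add, pow_zero, mul_one, RR, PowerSeries.coeff_mk] at this
  exact_mod_cast this

/-- The block with minimum `i`. -/
def blk (m : ℕ) (f : ℕ → ℕ) (i : ℕ) : Finset ℕ :=
  insert i ((Finset.Icc 1 m).filter (fun j => f j = i))

/-- The linked partition of a parent function. -/
def blks (m : ℕ) (f : ℕ → ℕ) : Finset (Finset ℕ) :=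
  ((Finset.Icc 1 m).filter (fun i => f i = 0 ∨ ∃ j, f j = i)).image (blk m f)

theorem IsMinOf.unique {i j : ℕ} {E : Finset ℕ} (h : IsMinOf i E) (h' : IsMinOf j E) : i = j :=
  le_antisymm (h.2 _ h'.1) (h'.2 _ h.1)

theorem mem_blk {m : ℕ} {f : ℕ → ℕ} (hf : PF m f) {i : ℕ} (hi : 1 ≤ i) (j : ℕ) :
    j ∈ blk m f i ↔ j = i ∨ f j = i := by
  have := hf.1 j
  simp only [blk, Finset.mem_insert, Finset.mem_filter, Finset.mem_Icc]
  omega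

theorem min_blk {m : ℕ} {f : ℕ → ℕ} (hf : PF m f) {i : ℕ} (hi : 1 ≤ i) :
    IsMinOf i (blk m f i) := by
  refine ⟨by simp [blk], fun j hj => ?_⟩
  rw [mem_blk hf hi] at hj
  have := hf.1 j
  omega

theorem mem_blks {m : ℕ} {f : ℕ → ℕ} {E : Finset ℕ} :
    E ∈ blks m f ↔ ∃ i, 1 ≤ i ∧ i ≤ m ∧ (f i = 0 ∨ ∃ j, f j = i) ∧ blk m f i = E := by
  simp only [blks, Finset.mem_image, Finset.mem_filter, Finset.mem_Icc]
  constructor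
  · rintro ⟨i, ⟨⟨h1, h2⟩, h3⟩, h4⟩
    exact ⟨i, h1, h2, h3, h4⟩
  · rintro ⟨i, h1, h2, h3, h4⟩
    exact ⟨i, ⟨⟨h1, h2⟩, h3⟩, h4⟩

theorem blks_NCL {m : ℕ} {f : ℕ → ℕ} (hf : PF m f) : IsNCL m (blks m f) := by
  refine ⟨?_, ?_, ?_⟩
  · intro E hE
    obtain ⟨i, h1, -, -, rfl⟩ := mem_blks.1 hE
    exact ⟨i, (min_blk hf h1).1⟩
  · ext j
    simp only [Finset.mem_biUnion, id, Finset.mem_Icc]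
    constructor
    · rintro ⟨E, hE, hj⟩
      obtain ⟨i, h1, h2, -, rfl⟩ := mem_blks.1 hE
      rw [mem_blk hf h1] at hj
      have := hf.1 j
      omega
    · rintro ⟨h1, h2⟩
      by_cases h0 : f j = 0
      · exact ⟨_, mem_blks.2 ⟨j, h1, h2, Or.inl h0, rfl⟩, (min_blk hf h1).1⟩
      · have := hf.1 j h0
        exact ⟨_, mem_blks.2 ⟨f j, by omega, by omega, Or.inr ⟨j, rfl⟩, rfl⟩,
          (mem_blk hf (by omega) j).2 (Or.inr rfl)⟩
  · intro E hE F hF hne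
    obtain ⟨a, a1, a2, a3, rfl⟩ := mem_blks.1 hE
    obtain ⟨b, b1, b2, b3, rfl⟩ := mem_blks.1 hF
    have hab : a ≠ b := by rintro rfl; exact hne rfl
    constructor
    · rintro ⟨i₁, hi₁, i₂, hi₂, j₁, hj₁, j₂, hj₂, h1, h2, h3⟩
      have ha := (min_blk hf a1).2 _ hi₁
      have hb := (min_blk hf b1).2 _ hj₁
      rw [mem_blk hf a1] at hi₁ hi₂
      rw [mem_blk hf b1] at hj₁ hj₂
      have fi : f i₂ = a := by omega
      have fj : f j₂ = b := by omega
      rcases lt_or_gt_of_ne hab with h | h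
      · exact hf.2 i₂ j₂ h3 (by omega) (by omega) (by omega)
      · have fj1 : f j₁ = b := by omega
        exact hf.2 j₁ i₂ h2 (by omega) (by omega) (by omega)
    · have aux : ∀ a b : ℕ, 1 ≤ a → 1 ≤ b → (f b = 0 ∨ ∃ j, f j = b) → a ≠ b →
          f b = a → ¬ IsMinOf b (blk m f a) ∧ IsMinOf b (blk m f b) ∧ 1 < (blk m f b).card := by
        intro a b a1 b1 b3 hab hfb
        refine ⟨fun h => hab ((min_blk hf a1).unique h), min_blk hf b1, ?_⟩
        obtain ⟨j, hj⟩ := b3.resolve_left (by omega)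
        rw [Finset.one_lt_card]
        refine ⟨b, (min_blk hf b1).1, j, (mem_blk hf b1 j).2 (Or.inr hj), ?_⟩
        have := hf.1 j
        omega
      intro x hx
      rw [Finset.mem_inter, mem_blk hf a1, mem_blk hf b1] at hx
      by_cases hxa : x = a
      · subst hxa
        have := aux b x b1 a1 a3 hab.symm (by omega)
        exact Or.inl ⟨this.2.1, this.2.2, this.1⟩
      · have hxb : x = b := by omega
        subst hxb
        exact Or.inr (aux a x a1 b1 b3 hab (by omega))

theorem blks_arc {m : ℕ} {f : ℕ → ℕ} (hf : PF m f) {i j : ℕ} (hi : i ≠ 0) :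
    f j = i ↔ ∃ E ∈ blks m f, IsMinOf i E ∧ j ∈ E ∧ i < j := by
  constructor
  · rintro rfl
    have := hf.1 j hi
    exact ⟨_, mem_blks.2 ⟨f j, by omega, by omega, Or.inr ⟨j, rfl⟩, rfl⟩, min_blk hf (by omega),
      (mem_blk hf (by omega) j).2 (Or.inr rfl), this.1⟩
  · rintro ⟨E, hE, hmin, hj, hlt⟩
    obtain ⟨a, a1, a2, a3, rfl⟩ := mem_blks.1 hE
    have := hmin.unique (min_blk hf a1)
    rw [mem_blk hf a1] at hj
    omega

theorem blks_inj {m : ℕ} {f g : ℕ → ℕ} (hf : PF m f) (hg : PF m g) (h : blks m f = blks m g) :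
    f = g := by
  have key : ∀ i j, i ≠ 0 → (f j = i ↔ g j = i) := by
    intro i j hi
    rw [blks_arc hf hi, blks_arc hg hi, h]
  funext j
  by_cases h0 : f j = 0
  · by_contra hne
    have := (key (g j) j (by omega)).2 rfl
    omega
  · exact ((key (f j) j h0).1 rfl).symm

theorem exists_min {E : Finset ℕ} (h : E.Nonempty) : ∃ i, IsMinOf i E :=
  ⟨E.min' h, E.min'_mem h, fun j hj => E.min'_le j hj⟩

theorem blks_surj {m : ℕ} {π : Finset (Finset ℕ)} (hπ : IsNCL m π) :
    ∃ f, PF m f ∧ blks m f = π := by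
  obtain ⟨hne, hun, hpair⟩ := hπ
  have hmem : ∀ E ∈ π, ∀ j ∈ E, 1 ≤ j ∧ j ≤ m := by
    intro E hE j hj
    have : j ∈ π.biUnion id := Finset.mem_biUnion.2 ⟨E, hE, hj⟩
    rwa [hun, Finset.mem_Icc] at this
  have hex : ∀ j, ∃ i, (i ≠ 0 → ∃ E ∈ π, IsMinOf i E ∧ j ∈ E ∧ i < j) ∧
      (i = 0 → ∀ E ∈ π, ∀ i, IsMinOf i E → j ∈ E → i < j → False) := by
    intro j
    by_cases h : ∃ E ∈ π, ∃ i, IsMinOf i E ∧ j ∈ E ∧ i < j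
    · obtain ⟨E, hE, i, h1, h2, h3⟩ := h
      refine ⟨i, fun _ => ⟨E, hE, h1, h2, h3⟩, fun h0 => ?_⟩
      have := hmem E hE i h1.1
      omega
    · refine ⟨0, fun h => absurd rfl h, fun _ E hE i h1 h2 h3 => h ⟨E, hE, i, h1, h2, h3⟩⟩
  choose f hf1 hf0 using hex
  -- two blocks with the same minimum coincide
  have hmin : ∀ E ∈ π, ∀ F ∈ π, ∀ i, IsMinOf i E → IsMinOf i F → E = F := by
    intro E hE F hF i h1 h2
    by_contra hEF
    rcases (hpair E hE F hF hEF).2 i (Finset.mem_inter.2 ⟨h1.1, h2.1⟩) with h | h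
    · exact h.2.2 h2
    · exact h.1 h1
  have hnon : ∀ E ∈ π, ∀ F ∈ π, ∀ j, j ∈ E → j ∈ F → ¬ IsMinOf j E → ¬ IsMinOf j F → E = F := by
    intro E hE F hF i h1 h2 h3 h4
    by_contra hEF
    rcases (hpair E hE F hF hEF).2 i (Finset.mem_inter.2 ⟨h1, h2⟩) with h | h
    · exact h3 h.1
    · exact h4 h.2.1
  have harc : ∀ E ∈ π, ∀ i j, IsMinOf i E → j ∈ E → i < j → f j = i := by
    intro E hE i j h1 h2 h3
    have h0 : f j ≠ 0 := fun h0 => hf0 j h0 E hE i h1 h2 h3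
    obtain ⟨F, hF, g1, g2, g3⟩ := hf1 j h0
    have : E = F := hnon E hE F hF j h2 g2 (fun h => by have := h.unique h1; omega)
      (fun h => by have := h.unique g1; omega)
    subst this
    exact g1.unique h1
  have hPF : PF m f := by
    refine ⟨fun j hj => ?_, ?_⟩
    · obtain ⟨F, hF, g1, g2, g3⟩ := hf1 j hj
      exact ⟨g3, (hmem F hF j g2).2⟩
    · intro c d hcd hc hcd' hdc
      obtain ⟨E, hE, e1, e2, e3⟩ := hf1 c hc
      obtain ⟨F, hF, g1, g2, g3⟩ := hf1 d (by omega)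
      have hEF : E ≠ F := by
        rintro rfl
        have := e1.unique g1
        omega
      exact (hpair E hE F hF hEF).1 ⟨f c, e1.1, c, e2, f d, g1.1, d, g2, hcd', hdc, hcd⟩
  have hblk : ∀ E ∈ π, ∀ i, IsMinOf i E → blk m f i = E := by
    intro E hE i hi
    have i1 := hmem E hE i hi.1
    ext j
    rw [mem_blk hPF i1.1]
    constructor
    · rintro (rfl | hj)
      · exact hi.1
      · obtain ⟨F, hF, g1, g2, g3⟩ := hf1 j (by omega)
        rw [hj] at g1
        rw [hmin E hE F hF i hi g1]
        exact g2
    · intro hj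
      have := hi.2 j hj
      by_cases hij : j = i
      · exact Or.inl hij
      · exact Or.inr (harc E hE i j hi hj (by omega))
  refine ⟨f, hPF, ?_⟩
  ext E
  rw [mem_blks]
  constructor
  · rintro ⟨i, i1, i2, h0 | ⟨j, hj⟩, rfl⟩
    · have : i ∈ π.biUnion id := by rw [hun, Finset.mem_Icc]; exact ⟨i1, i2⟩
      obtain ⟨E, hE, hiE⟩ := Finset.mem_biUnion.1 this
      obtain ⟨a, ha⟩ := exists_min (hne E hE)
      have hle := ha.2 i hiE
      have : a = i := by
        by_contra hai
        exact hf0 i h0 E hE a ha hiE (by omega)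
      subst this
      rw [hblk E hE a ha]
      exact hE
    · obtain ⟨F, hF, g1, g2, g3⟩ := hf1 j (by omega)
      rw [hj] at g1
      rw [hblk F hF i g1]
      exact hF
  · intro hE
    obtain ⟨a, ha⟩ := exists_min (hne E hE)
    have a1 := hmem E hE a ha.1
    refine ⟨a, a1.1, a1.2, ?_, hblk E hE a ha⟩
    by_cases h0 : f a = 0
    · exact Or.inl h0
    · right
      obtain ⟨F, hF, g1, g2, g3⟩ := hf1 a h0
      have hEF : E ≠ F := by
        rintro rfl
        have := g1.unique ha
        omega
      have hcard : 1 < E.card := by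
        rcases (hpair E hE F hF hEF).2 a (Finset.mem_inter.2 ⟨ha.1, g2⟩) with h | h
        · exact h.2.1
        · exact absurd ha h.1
      obtain ⟨j, hj, hja⟩ := Finset.exists_mem_ne hcard a
      have := ha.2 j hj
      exact ⟨j, harc E hE a j ha hj (by omega)⟩

theorem mem_NCLset {m : ℕ} {π : Finset (Finset ℕ)} : π ∈ NCLset m ↔ IsNCL m π := by
  simp only [NCLset, Finset.mem_filter, Finset.mem_powerset, and_iff_right_iff_imp]
  intro h E hE
  rw [Finset.mem_powerset, ← h.2.1]
  exact Finset.subset_biUnion_of_mem id hE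

/-- The number of noncrossing linked partitions of `{1,...,n+1}` is the large
Schröder number `rₙ`. -/
theorem card_NCL_eq_schroder (n : ℕ) :
    (NCLset (n + 1)).card = schroder n := by
  have h0 : PF 0 (fun _ => 0) := ⟨fun j hj => absurd rfl hj, fun c d _ h => absurd rfl h⟩
  have hmem : ∀ g, g ∈ extn (n + 1) 0 (fun _ => 0) ↔ PF (n + 1) g := by
    intro g
    rw [mem_extn _ _ _ h0, zero_add]
    refine ⟨fun h => h.1, fun h => ⟨h, fun j hj => ?_⟩⟩
    by_contra hne
    have := h.1 j hne
    omega
  have hc := card_extn (n + 1) 0 _ h0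
  have hv : (vis 0 (fun _ => 0)).card = 0 := by simp [vis]
  rw [hv, gt, Finset.sum_range_zero, add_zero, zero_add, gt_schroder] at hc
  rw [← hc]
  symm
  refine Finset.card_bij (fun f _ => blks (n + 1) f) ?_ ?_ ?_
  · intro f hf
    exact mem_NCLset.2 (blks_NCL ((hmem f).1 hf))
  · intro f hf g hg h
    exact blks_inj ((hmem f).1 hf) ((hmem g).1 hg) h
  · intro π hπ
    obtain ⟨f, hf, h⟩ := blks_surj (mem_NCLset.1 hπ)
    exact ⟨f, (hmem f).2 hf, h⟩
end
end

section
/- Let B be an algebra over a field of characteristic zero and let Sym denote the symmetrization operator on Mul[[B]]. For α, β ∈ Mul[[B]], Sym(αβ) = Sym((Sym α)β) = Sym(α(Sym β)); and if β_0 = 0, then Sym(α ∘ β) = Sym(α ∘ (Sym β)) = Sym((Sym α) ∘ β). -/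
/-!  Formal multilinear function series over an algebra `B`, encoded as functions
`F : List B → B`; the `n`-th term of the series is the restriction of `F` to
lists of length `n` (so `F [] = α₀`, `F [b] = α₁(b)`, etc.). -/

/-- `F : List B → B` is a formal multilinear function series over the `K`-algebra
`B`: it is `K`-multilinear in the entries of lists of each fixed length. -/
def IsMulSeries (K : Type*) [Field K] {B : Type*} [Ring B] [Algebra K B]
    (F : List B → B) : Prop :=
  ∀ (p s : List B) (c : K) (x y : B),
    F (p ++ (c • x + y) :: s) = c • F (p ++ x :: s) + F (p ++ y :: s)

/-- The formal product:
`(αβ)ₙ(b₁,...,bₙ) = ∑_{k=0}^n αₖ(b₁,...,bₖ) β_{n-k}(b_{k+1},...,bₙ)`. -/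
def fmul {B : Type*} [Ring B] (α β : List B → B) : List B → B :=
  fun l => ∑ i ∈ Finset.range (l.length + 1), α (List.take i l) * β (List.drop i l)

/-- All decompositions of a list into consecutive nonempty blocks. -/
def comps {X : Type*} : List X → List (List (List X))
  | [] => [[]]
  | a :: t =>
      ((comps t).map fun c => [a] :: c) ++
      ((comps t).filterMap fun c =>
        match c with
        | [] => none
        | b :: bs => some ((a :: b) :: bs))

/-- The formal composition:
`(α∘β)ₙ(b₁,...,bₙ) = ∑_{k=1}^n ∑_{p₁+⋯+p_k=n, pᵢ≥1}
   αₖ(β_{p₁}(b₁,...,b_{p₁}), ..., β_{p_k}(b_{q_k+1},...,b_{q_k+p_k}))`,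
with `(α∘β)₀ = α₀`. -/
def fcomp {B : Type*} [Ring B] (α β : List B → B) : List B → B :=
  fun l => ((comps l).map fun c => α (c.map β)).sum

/-- The multiplicative identity `1 = (1, 0, 0, ...)` of `Mul[[B]]`. -/
def fmfsOne {B : Type*} [Ring B] : List B → B
  | [] => 1
  | _ :: _ => 0

/-- The compositional identity `I = (0, id_B, 0, 0, ...)` of `Mul[[B]]`. -/
def fmfsI {B : Type*} [Ring B] : List B → B
  | [x] => x
  | _ => 0

/-- The symmetrization operator on formal multilinear function series:
`(Sym F)ₙ(b₁,...,bₙ) = (1/n!) ∑_{σ ∈ Sₙ} Fₙ(b_{σ(1)},...,b_{σ(n)})`. -/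
noncomputable def fsym (K : Type*) [Field K] {B : Type*} [Ring B] [Algebra K B]
    (F : List B → B) : List B → B :=
  fun l => ((l.length.factorial : K))⁻¹ •
    ∑ σ : Equiv.Perm (Fin l.length), F (List.ofFn fun i => l.get (σ i))

variable {K : Type*} [Field K] [CharZero K] {B : Type*} [Ring B] [Algebra K B]

/-- Sum of `F` over all rearrangements of `l`. -/
def gsum {X M : Type*} [AddCommMonoid M] (F : List X → M) (l : List X) : M :=
  ∑ σ : Equiv.Perm (Fin l.length), F (List.ofFn fun i => l.get (σ i))

theorem gsum_eq {X M : Type*} [AddCommMonoid M] (F : List X → M) (l : List X) (n : ℕ)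
    (h : l.length = n) :
    gsum F l = ∑ σ : Equiv.Perm (Fin n), F (List.ofFn fun i => l.get (Fin.cast h.symm (σ i))) := by
  subst h; rfl

theorem gsum_map {X Y M : Type*} [AddCommMonoid M] (F : List Y → M) (g : X → Y) (l : List X) :
    gsum F (l.map g) = gsum (fun m => F (m.map g)) l := by
  rw [gsum_eq F (l.map g) l.length (by simp)]
  unfold gsum
  refine Finset.sum_congr rfl fun σ _ => ?_
  congr 1
  rw [List.map_ofFn]
  congr 1
  funext i
  simp

theorem gsum_congr_perm {X M : Type*} [AddCommMonoid M] (F G : List X → M) (l : List X)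
    (h : ∀ m, m.Perm l → F m = G m) : gsum F l = gsum G l := by
  unfold gsum
  refine Finset.sum_congr rfl fun σ _ => h _ ?_
  have := Equiv.Perm.ofFn_comp_perm σ l.get
  rw [List.ofFn_get] at this
  exact this

theorem gsum_sum {X M ι : Type*} [AddCommMonoid M] (s : Finset ι) (F : ι → List X → M)
    (l : List X) : gsum (fun m => ∑ i ∈ s, F i m) l = ∑ i ∈ s, gsum (F i) l := by
  unfold gsum
  rw [Finset.sum_comm]

theorem avg_const (K : Type*) [Field K] [CharZero K] {M : Type*} [AddCommGroup M] [Module K M]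
    {X : Type*} (l : List X) (x : M) :
    ((l.length.factorial : K))⁻¹ • gsum (fun _ : List X => x) l = x := by
  unfold gsum
  rw [Finset.sum_const, Finset.card_univ, Fintype.card_perm, Fintype.card_fin,
    ← Nat.cast_smul_eq_nsmul K, smul_smul, inv_mul_cancel₀, one_smul]
  exact_mod_cast Nat.factorial_ne_zero _

theorem exists_perm_map {n : ℕ} (L : List (Fin n)) (h : L.Perm (List.finRange n)) :
    ∃ τ : Equiv.Perm (Fin n), L = (List.finRange n).map τ := by
  have hl : L.length = n := by simpa using h.length_eq
  have hn : L.Nodup := h.nodup_iff.2 (List.nodup_finRange n)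
  have hinj : Function.Injective (fun i : Fin n => L.get (Fin.cast hl.symm i)) := by
    intro i j hij
    have := (List.nodup_iff_injective_get.1 hn) hij
    simpa using this
  refine ⟨Equiv.ofBijective _ (Finite.injective_iff_bijective.1 hinj), ?_⟩
  apply List.ext_get
  · simp [hl]
  · intro i h1 h2
    simp

/-- The sum of `H` over all simultaneous relabelings of the blocks of `c`. -/
def wsum {n : ℕ} {M : Type*} [AddCommMonoid M] (H : List (List (Fin n)) → M)
    (c : List (List (Fin n))) : M :=
  ∑ σ : Equiv.Perm (Fin n), H (c.map (List.map σ))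

theorem wsum_std {n : ℕ} {M : Type*} [AddCommMonoid M] (H : List (List (Fin n)) → M)
    (c : List (List (Fin n))) (h : c.flatten.Perm (List.finRange n)) :
    wsum H c = wsum H ((c.map List.length).splitLengths (List.finRange n)) := by
  obtain ⟨τ, hτ⟩ := exists_perm_map _ h
  have hs : (c.map List.length).sum = n := by
    rw [← List.length_flatten, h.length_eq]; simp
  have hc : c = ((c.map List.length).splitLengths (List.finRange n)).map (List.map τ) := by
    rw [List.eq_iff_flatten_eq]
    constructor
    · rw [← List.map_flatten, List.flatten_splitLengths _ _ (by simp [hs]), hτ]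
    · rw [List.map_map]
      have : List.length ∘ List.map (τ : Fin n → Fin n) = List.length := by funext; simp
      rw [this, List.map_splitLengths_length _ _ (by simp [hs])]
  conv_lhs => rw [hc]
  unfold wsum
  refine Fintype.sum_equiv (Equiv.mulRight τ) _ _ fun σ => ?_
  rw [List.map_map]
  congr 2
  funext b
  simp

theorem wsum_congr {n : ℕ} {M : Type*} [AddCommMonoid M] (H : List (List (Fin n)) → M)
    (c d : List (List (Fin n))) (h : c.flatten.Perm (List.finRange n))
    (h' : d.flatten.Perm c.flatten) (hl : d.map List.length = c.map List.length) :
    wsum H d = wsum H c := by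
  rw [wsum_std H c h, wsum_std H d (h'.trans h), hl]

theorem wsum_gsum {n : ℕ} {M : Type*} [AddCommGroup M] (K : Type*) [Field K] [CharZero K]
    [Module K M] (H : List (List (Fin n)) → M)
    (p s : List (List (Fin n))) (b : List (Fin n))
    (h : (p ++ b :: s).flatten.Perm (List.finRange n)) :
    ((b.length.factorial : K))⁻¹ • gsum (fun m => wsum H (p ++ m :: s)) b
      = wsum H (p ++ b :: s) := by
  rw [gsum_congr_perm _ (fun _ => wsum H (p ++ b :: s)) b, avg_const]
  intro m hm
  refine wsum_congr _ _ _ h ?_ ?_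
  · simp only [List.flatten_append, List.flatten_cons]
    exact List.Perm.append_left _ (List.Perm.append_right _ hm)
  · simp [hm.length_eq]

/-! Multilinearity. -/

theorem mul_zero_entry {α : List B → B} (hα : IsMulSeries K α) (p s : List B) :
    α (p ++ 0 :: s) = 0 := by
  have := hα p s 1 0 0
  simpa using this

theorem mul_smul_entry {α : List B → B} (hα : IsMulSeries K α) (p s : List B) (c : K) (x : B) :
    α (p ++ (c • x) :: s) = c • α (p ++ x :: s) := by
  have := hα p s c x 0
  rwa [add_zero, mul_zero_entry hα, add_zero] at this

theorem mul_sum_entry {α : List B → B} (hα : IsMulSeries K α) (p s : List B) {ι : Type*}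
    (S : Finset ι) (f : ι → B) :
    α (p ++ (∑ i ∈ S, f i) :: s) = ∑ i ∈ S, α (p ++ f i :: s) := by
  classical
  induction S using Finset.induction_on with
  | empty => simpa using mul_zero_entry hα p s
  | insert a S ha ih =>
    rw [Finset.sum_insert ha, Finset.sum_insert ha, ← ih]
    have := hα p s 1 (f a) (∑ i ∈ S, f i)
    simpa using this

theorem mul_gsum_entry {α : List B → B} (hα : IsMulSeries K α) (p s : List B) {X : Type*}
    (F : List X → B) (b : List X) :
    α (p ++ gsum F b :: s) = gsum (fun m => α (p ++ F m :: s)) b :=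
  mul_sum_entry hα p s _ _

theorem fsym_map (F : List B → B) {X : Type*} (g : X → B) (l : List X) :
    fsym K F (l.map g) = ((l.length.factorial : K))⁻¹ • gsum (fun m => F (m.map g)) l := by
  rw [← gsum_map, ← List.length_map (f := g) (as := l)]
  rfl

/-- Two series have the same symmetrization as soon as their relabeled sums agree. -/
theorem fsym_ext (F G : List B → B)
    (h : ∀ (n : ℕ) (g : Fin n → B),
      ∑ σ : Equiv.Perm (Fin n), F (((List.finRange n).map σ).map g)
        = ∑ σ : Equiv.Perm (Fin n), G (((List.finRange n).map σ).map g)) :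
    fsym K F = fsym K G := by
  funext l
  have key : ∀ σ : Equiv.Perm (Fin l.length),
      (List.ofFn fun i => l.get (σ i)) = ((List.finRange l.length).map σ).map l.get := by
    intro σ
    rw [List.map_map, List.ofFn_eq_map]; rfl
  unfold fsym
  simp only [key]
  rw [h]

/-! Products. -/

theorem fmul_map {X : Type*} (α β : List B → B) (g : X → B) (l : List X) :
    fmul α β (l.map g) = ∑ i ∈ Finset.range (l.length + 1),
      α ((l.take i).map g) * β ((l.drop i).map g) := by
  simp [fmul, List.map_take, List.map_drop]

theorem gsum_smul_wsum {n : ℕ} (H : List (List (Fin n)) → B) (b : List (Fin n)) (c : K)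
    (D : List (Fin n) → List (List (Fin n))) :
    ∑ σ : Equiv.Perm (Fin n), c • gsum (fun m => H ((D m).map (List.map σ))) b
      = c • gsum (fun m => wsum H (D m)) b := by
  rw [← Finset.smul_sum]
  unfold wsum
  rw [gsum_sum]

theorem fmul_left (α β : List B → B) : fsym K (fmul α β) = fsym K (fmul (fsym K α) β) := by
  apply fsym_ext
  intro n g
  simp only [fmul_map, ← List.map_take, ← List.map_drop]
  simp only [List.length_map, List.length_finRange]
  rw [Finset.sum_comm]
  conv_rhs => rw [Finset.sum_comm]
  refine Finset.sum_congr rfl fun i _ => ?_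
  have hw := wsum_gsum K (fun c : List (List (Fin n)) =>
      α ((c.getD 0 []).map g) * β ((c.getD 1 []).map g)) [] [(List.finRange n).drop i]
      ((List.finRange n).take i) (by simp)
  rw [← gsum_smul_wsum] at hw
  refine Eq.trans ?_ (hw.symm.trans ?_)
  · simp [wsum]
  refine Finset.sum_congr rfl fun σ _ => ?_
  rw [List.map_map, fsym_map, smul_mul_assoc]
  congr 1
  simp [gsum, Finset.sum_mul, Function.comp_def]

theorem fmul_right (α β : List B → B) : fsym K (fmul α β) = fsym K (fmul α (fsym K β)) := by
  apply fsym_ext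
  intro n g
  simp only [fmul_map, ← List.map_take, ← List.map_drop]
  simp only [List.length_map, List.length_finRange]
  rw [Finset.sum_comm]
  conv_rhs => rw [Finset.sum_comm]
  refine Finset.sum_congr rfl fun i _ => ?_
  have hw := wsum_gsum K (fun c : List (List (Fin n)) =>
      α ((c.getD 0 []).map g) * β ((c.getD 1 []).map g)) [(List.finRange n).take i] []
      ((List.finRange n).drop i) (by simp)
  rw [← gsum_smul_wsum] at hw
  refine Eq.trans ?_ (hw.symm.trans ?_)
  · simp [wsum]
  refine Finset.sum_congr rfl fun σ _ => ?_
  rw [List.map_map, List.map_map, fsym_map, mul_smul_comm]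
  congr 1
  simp [gsum, Finset.mul_sum, Function.comp_def]

/-! Compositions. -/

theorem comps_map {X Y : Type*} (g : X → Y) (l : List X) :
    comps (l.map g) = (comps l).map (List.map (List.map g)) := by
  induction l with
  | nil => simp [comps]
  | cons a t ih =>
    simp only [List.map_cons, comps, ih, List.map_append, List.map_map, List.filterMap_map,
      List.map_filterMap]
    congr 1
    congr 1
    funext c
    cases c <;> simp

theorem comps_flatten {X : Type*} (l : List X) : ∀ c ∈ comps l, c.flatten = l := by
  induction l with
  | nil => simp [comps]
  | cons a t ih =>
    intro c hc
    simp only [comps, List.mem_append, List.mem_map, List.mem_filterMap] at hc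
    rcases hc with ⟨d, hd, rfl⟩ | ⟨d, hd, h⟩
    · simp [ih d hd]
    · cases d with
      | nil => simp at h
      | cons b bs =>
        simp only [Option.some.injEq] at h
        subst h
        have := ih _ hd
        simp only [List.flatten_cons] at this ⊢
        simp [← this]

/-- The shapes of the decompositions of a list of length `n`. -/
def shapes : ℕ → List (List ℕ)
  | 0 => [[]]
  | n + 1 =>
      ((shapes n).map fun c => 1 :: c) ++
      ((shapes n).filterMap fun c =>
        match c with
        | [] => none
        | b :: bs => some ((b + 1) :: bs))

theorem comps_shapes {X : Type*} (l : List X) :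
    (comps l).map (List.map List.length) = shapes l.length := by
  induction l with
  | nil => simp [comps, shapes]
  | cons a t ih =>
    simp only [List.length_cons, comps, shapes, ← ih, List.map_append, List.map_map,
      List.filterMap_map, List.map_filterMap]
    congr 1
    congr 1
    funext c
    cases c <;> simp

theorem mem_shapes (n : ℕ) : ∀ s, s ∈ shapes n ↔ (∀ x ∈ s, 0 < x) ∧ s.sum = n := by
  induction n with
  | zero =>
    intro s
    cases s with
    | nil => simp [shapes]
    | cons x s =>
      simp [shapes]
      intros; omega
  | succ n ih =>
    intro s
    simp only [shapes, List.mem_append, List.mem_map, List.mem_filterMap]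
    constructor
    · rintro (⟨d, hd, rfl⟩ | ⟨d, hd, h⟩)
      · obtain ⟨h1, h2⟩ := (ih d).1 hd
        refine ⟨?_, by simp [h2]; omega⟩
        simpa using h1
      · cases d with
        | nil => simp at h
        | cons b bs =>
          simp only [Option.some.injEq] at h
          subst h
          obtain ⟨h1, h2⟩ := (ih _).1 hd
          simp at h1 h2 ⊢
          exact ⟨h1.2, by omega⟩
    · rintro ⟨h1, h2⟩
      cases s with
      | nil => simp at h2
      | cons x s =>
        simp at h1 h2
        by_cases hx : x = 1
        · left
          exact ⟨s, (ih s).2 ⟨h1.2, by omega⟩, by rw [hx]⟩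
        · right
          refine ⟨(x - 1) :: s, (ih _).2 ⟨?_, ?_⟩, ?_⟩
          · simp
            exact ⟨by omega, h1.2⟩
          · simp; omega
          · simp; omega

theorem nodup_shapes (n : ℕ) : (shapes n).Nodup := by
  induction n with
  | zero => simp [shapes]
  | succ n ih =>
    simp only [shapes]
    refine List.Nodup.append ?_ ?_ ?_
    · exact ih.map (fun a b h => by simpa using h)
    · refine ih.filterMap ?_
      intro a b c h1 h2
      cases a <;> cases b <;> simp at h1 h2
      subst h1
      simp at h2
      simp [h2]
    · intro s h1 h2
      simp only [List.mem_map, List.mem_filterMap] at h1 h2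
      obtain ⟨d, _, rfl⟩ := h1
      obtain ⟨e, he, h⟩ := h2
      cases e with
      | nil => simp at h
      | cons b bs =>
        have := ((mem_shapes n _).1 he).1 b (by simp)
        simp at h
        omega

/-- Rearrangement of the lists of length `k` by `ρ`. -/
def actList {X : Type*} (k : ℕ) (ρ : Equiv.Perm (Fin k)) (s : List X) : List X :=
  if h : s.length = k then List.ofFn fun i => s.get (Fin.cast h.symm (ρ i)) else s

theorem actList_perm {X : Type*} (k : ℕ) (ρ : Equiv.Perm (Fin k)) (s : List X) :
    (actList k ρ s).Perm s := by
  unfold actList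
  split_ifs with h
  · subst h
    have := Equiv.Perm.ofFn_comp_perm ρ s.get
    rw [List.ofFn_get] at this
    exact this
  · exact List.Perm.refl _

theorem actList_inv {X : Type*} (k : ℕ) (ρ ρ' : Equiv.Perm (Fin k)) (h' : ∀ i, ρ (ρ' i) = i)
    (s : List X) :
    actList k ρ' (actList k ρ s) = s := by
  by_cases h : s.length = k
  · have h2 : (actList k ρ s).length = k := by rw [(actList_perm k ρ s).length_eq, h]
    apply List.ext_get
    · rw [(actList_perm _ _ _).length_eq, (actList_perm _ _ _).length_eq]
    · intro i h3 h4
      unfold actList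
      simp [h, h']
  · simp [actList, h]

theorem sum_avg {M : Type*} [AddCommGroup M] (K : Type*) [Field K] [CharZero K] [Module K M]
    {X : Type*} (S : Finset (List X)) (hS : ∀ s ∈ S, ∀ t, t.Perm s → t ∈ S) (Φ : List X → M) :
    ∑ s ∈ S, ((s.length.factorial : K))⁻¹ • gsum Φ s = ∑ s ∈ S, Φ s := by
  classical
  have hm : ∀ s ∈ S, s.length ∈ S.image List.length := fun s hs => Finset.mem_image_of_mem _ hs
  rw [← Finset.sum_fiberwise_of_maps_to hm, ← Finset.sum_fiberwise_of_maps_to hm]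
  refine Finset.sum_congr rfl fun k _ => ?_
  have e1 : ∑ s ∈ S with s.length = k, ((s.length.factorial : K))⁻¹ • gsum Φ s
      = ∑ s ∈ S with s.length = k,
        ((k.factorial : K))⁻¹ • ∑ ρ : Equiv.Perm (Fin k), Φ (actList k ρ s) := by
    refine Finset.sum_congr rfl fun s hs => ?_
    have h := (Finset.mem_filter.1 hs).2
    rw [gsum_eq Φ s k h, congrArg Nat.factorial h]
    simp only [actList, h, dite_true]
  rw [e1, ← Finset.smul_sum, Finset.sum_comm]
  have e2 : ∀ ρ : Equiv.Perm (Fin k), ∑ s ∈ S with s.length = k, Φ (actList k ρ s)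
      = ∑ s ∈ S with s.length = k, Φ s := by
    intro ρ
    have mem : ∀ (ρ : Equiv.Perm (Fin k)), ∀ s ∈ S.filter (fun s => s.length = k),
        actList k ρ s ∈ S.filter (fun s => s.length = k) := by
      intro ρ s hs
      rw [Finset.mem_filter] at hs ⊢
      exact ⟨hS s hs.1 _ (actList_perm _ _ _), by rw [(actList_perm _ _ _).length_eq, hs.2]⟩
    refine Finset.sum_bij' (fun s _ => actList k ρ s) (fun s _ => actList k ρ⁻¹ s)
      (mem ρ) (mem ρ⁻¹) ?_ ?_ ?_
    · intro s _; exact actList_inv _ _ _ (by simp) _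
    · intro s _; exact actList_inv _ _ _ (by simp) _
    · intro s _; rfl
  simp only [e2]
  rw [Finset.sum_const, Finset.card_univ, Fintype.card_perm, Fintype.card_fin,
    ← Nat.cast_smul_eq_nsmul K, smul_smul, inv_mul_cancel₀, one_smul]
  exact_mod_cast Nat.factorial_ne_zero _

theorem sum_list_sum {ι κ M : Type*} [AddCommMonoid M] (s : Finset ι) (L : List κ)
    (f : ι → κ → M) :
    ∑ i ∈ s, (L.map (f i)).sum = (L.map fun c => ∑ i ∈ s, f i c).sum := by
  induction L with
  | nil => simp
  | cons a t ih => simp [Finset.sum_add_distrib, ih]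

theorem fcomp_sum (α β : List B → B) (n : ℕ) (g : Fin n → B) :
    ∑ σ : Equiv.Perm (Fin n), fcomp α β (((List.finRange n).map σ).map g)
      = ((comps (List.finRange n)).map
          (wsum fun c => α (c.map fun b => β (b.map g)))).sum := by
  simp only [fcomp, comps_map, List.map_map]
  rw [sum_list_sum]
  congr 1
  refine List.map_congr_left fun c _ => ?_
  unfold wsum
  refine Finset.sum_congr rfl fun σ _ => ?_
  simp [Function.comp_def]

theorem comp_right_aux (α β : List B → B) (hα : IsMulSeries K α) (n : ℕ) (g : Fin n → B)
    (c : List (List (Fin n))) : ∀ p : List (List (Fin n)),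
    (p ++ c).flatten.Perm (List.finRange n) →
    ∑ σ : Equiv.Perm (Fin n),
      α (p.map (fun b => β ((b.map σ).map g)) ++ c.map (fun b => fsym K β ((b.map σ).map g)))
    = wsum (fun c => α (c.map fun b => β (b.map g))) (p ++ c) := by
  induction c with
  | nil =>
    intro p _
    simp [wsum, Function.comp_def]
  | cons b c ih =>
    intro p hp
    rw [← wsum_gsum K _ p c b hp]
    rw [gsum_congr_perm _ (fun m => ∑ σ : Equiv.Perm (Fin n),
      α (p.map (fun b => β ((b.map σ).map g)) ++
        β ((m.map σ).map g) :: c.map (fun b => fsym K β ((b.map σ).map g)))) b]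
    · rw [gsum_sum, Finset.smul_sum]
      refine Finset.sum_congr rfl fun σ _ => ?_
      rw [List.map_cons, List.map_map, fsym_map, mul_smul_entry hα, mul_gsum_entry hα]
      simp only [List.map_map]
    · intro m hm
      have := ih (p ++ [m]) ?_
      · simp only [List.append_assoc, List.map_append, List.map_cons, List.map_nil,
          List.singleton_append] at this
        exact this.symm
      · refine List.Perm.trans ?_ hp
        simp only [List.flatten_append, List.flatten_cons, List.flatten_nil, List.append_nil,
          List.append_assoc]
        exact List.Perm.append_left _ (List.Perm.append_right _ hm)

theorem fcomp_right (α β : List B → B) (hα : IsMulSeries K α) :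
    fsym K (fcomp α β) = fsym K (fcomp α (fsym K β)) := by
  apply fsym_ext
  intro n g
  rw [fcomp_sum, fcomp_sum]
  congr 1
  refine List.map_congr_left fun c hc => ?_
  have := comp_right_aux α β hα n g c [] (by simp [comps_flatten _ c hc])
  simp only [List.nil_append, List.map_nil] at this
  rw [← this]
  simp only [wsum, List.map_map, Function.comp_def]

theorem fcomp_left (α β : List B → B) :
    fsym K (fcomp α β) = fsym K (fcomp (fsym K α) β) := by
  apply fsym_ext
  intro n g
  rw [fcomp_sum, fcomp_sum]
  set H : List (List (Fin n)) → B := fun c => α (c.map fun b => β (b.map g)) with hH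
  set Φ : List ℕ → B := fun s => wsum H (s.splitLengths (List.finRange n)) with hΦ
  have e1 : (comps (List.finRange n)).map (wsum H) = (shapes n).map Φ := by
    have := comps_shapes (List.finRange n)
    rw [List.length_finRange] at this
    rw [← this, List.map_map]
    refine List.map_congr_left fun c hc => ?_
    exact wsum_std H c (by rw [comps_flatten _ c hc])
  have e2 : (comps (List.finRange n)).map
        (wsum fun c => fsym K α (c.map fun b => β (b.map g)))
      = (shapes n).map (fun s => ((s.length.factorial : K))⁻¹ • gsum Φ s) := by
    have := comps_shapes (List.finRange n)
    rw [List.length_finRange] at this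
    rw [← this, List.map_map]
    refine List.map_congr_left fun c hc => ?_
    simp only [Function.comp_apply, List.length_map]
    rw [gsum_map, ← gsum_congr_perm (wsum H)]
    · unfold wsum
      rw [gsum_sum, Finset.smul_sum]
      refine Finset.sum_congr rfl fun σ _ => ?_
      beta_reduce
      rw [List.map_map, fsym_map]
      simp only [hH, List.map_map]
    · intro m hm
      refine wsum_std H m ?_
      have := hm.flatten
      rwa [comps_flatten _ c hc] at this
  rw [e1, e2]
  have hn := nodup_shapes n
  rw [← List.sum_toFinset _ hn, ← List.sum_toFinset _ hn, sum_avg]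
  intro s hs t hts
  rw [List.mem_toFinset, mem_shapes] at hs ⊢
  exact ⟨fun x hx => hs.1 x (hts.mem_iff.1 hx), by rw [hts.sum_eq, hs.2]⟩

/-- Over a field of characteristic zero,
`Sym(αβ) = Sym((Sym α)β) = Sym(α(Sym β))`, and if `β₀ = 0` then
`Sym(α ∘ β) = Sym(α ∘ (Sym β)) = Sym((Sym α) ∘ β)`. -/
theorem fsym_fmul_fcomp (α β : List B → B)
    (hα : IsMulSeries K α) (hβ : IsMulSeries K β) :
    (fsym K (fmul α β) = fsym K (fmul (fsym K α) β) ∧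
      fsym K (fmul α β) = fsym K (fmul α (fsym K β))) ∧
    (β [] = 0 →
      fsym K (fcomp α β) = fsym K (fcomp α (fsym K β)) ∧
      fsym K (fcomp α β) = fsym K (fcomp (fsym K α) β)) := by
  exact ⟨⟨fmul_left α β, fmul_right α β⟩, fun _ =>
    ⟨fcomp_right α β hα, fcomp_left α β⟩⟩
end

section
/- Let B be an algebra over a field, let β ∈ Mul[[B]] and let α = I + IβI, where I = (0, id_B, 0, ...). Then α has a compositional inverse α°⁻¹ in Mul[[B]], and there is a unique γ ∈ Mul[[B]] such that α°⁻¹ = (1 + Iγ)^{-1} I; moreover γ = ((1 + βI)^{-1} β) ∘ α°⁻¹. -/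
/-- Sum over all splittings of a list into a prefix and a suffix. -/
def spl {X M : Type*} [AddCommMonoid M] : (List X → List X → M) → List X → M
  | φ, [] => φ [] []
  | φ, a :: t => φ [] (a :: t) + spl (fun u v => φ (a :: u) v) t

theorem spl_congr {X M : Type*} [AddCommMonoid M] (t : List X) :
    ∀ (φ ψ : List X → List X → M), (∀ u v, u ++ v = t → φ u v = ψ u v) → spl φ t = spl ψ t := by
  induction t with
  | nil => intro φ ψ h; exact h [] [] rfl
  | cons a t ih =>
    intro φ ψ h
    simp only [spl]
    rw [h [] (a :: t) rfl]
    congr 1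
    apply ih
    intro u v huv
    exact h _ _ (by simp [huv])

theorem spl_add {X M : Type*} [AddCommMonoid M] (t : List X) :
    ∀ (φ ψ : List X → List X → M), spl (fun u v => φ u v + ψ u v) t = spl φ t + spl ψ t := by
  induction t with
  | nil => intro φ ψ; rfl
  | cons a t ih =>
    intro φ ψ
    simp only [spl, ih]
    abel

theorem spl_zero {X M : Type*} [AddCommMonoid M] (t : List X) :
    spl (fun _ _ => (0 : M)) t = 0 := by
  induction t with
  | nil => rfl
  | cons a t ih => simp only [spl, ih, add_zero]

theorem spl_hom {X M N : Type*} [AddCommMonoid M] [AddCommMonoid N] (L : M →+ N) (t : List X) :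
    ∀ (φ : List X → List X → M), L (spl φ t) = spl (fun u v => L (φ u v)) t := by
  induction t with
  | nil => intro φ; rfl
  | cons a t ih =>
    intro φ
    simp only [spl, ih, map_add]

theorem spl_assoc {X M : Type*} [AddCommMonoid M] (t : List X) :
    ∀ (φ : List X → List X → List X → M),
      spl (fun u v => spl (fun x y => φ x y v) u) t =
        spl (fun x w => spl (fun y v => φ x y v) w) t := by
  induction t with
  | nil => intro φ; rfl
  | cons a t ih =>
    intro φ
    simp only [spl, spl_add]
    rw [ih (fun x y v => φ (a :: x) y v)]
    abel

theorem spl_left {X M : Type*} [AddCommMonoid M] (t : List X) (φ : List X → List X → M)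
    (h : ∀ a u v, φ (a :: u) v = 0) : spl φ t = φ [] t := by
  cases t with
  | nil => rfl
  | cons a t => simp only [spl, h, spl_zero, add_zero]

theorem spl_right {X M : Type*} [AddCommMonoid M] (t : List X) :
    ∀ (φ : List X → List X → M) (_ : ∀ u a v, φ u (a :: v) = 0), spl φ t = φ t [] := by
  induction t with
  | nil => intro φ h; rfl
  | cons a t ih =>
    intro φ h
    simp only [spl, h, zero_add]
    rw [ih]
    intro u b v; exact h _ _ _

theorem fmul_eq_spl {B : Type*} [Ring B] (f g : List B → B) (l : List B) :
    fmul f g l = spl (fun u v => f u * g v) l := by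
  induction l generalizing f with
  | nil => simp [fmul, spl]
  | cons a t ih =>
    simp only [spl]
    rw [← ih (fun u => f (a :: u))]
    simp only [fmul, List.length_cons]
    rw [Finset.sum_range_succ']
    simp [add_comm]

theorem sum_filterMap_aux {X M : Type*} [AddCommMonoid M] (a : X) (Ψ : List (List X) → M)
    (L : List (List (List X))) :
    ((L.filterMap fun c =>
        match c with
        | [] => none
        | b :: bs => some ((a :: b) :: bs)).map Ψ).sum =
      (L.map fun c => match c with
        | [] => 0
        | b :: bs => Ψ ((a :: b) :: bs)).sum := by
  induction L with
  | nil => rfl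
  | cons c L ih =>
    cases c with
    | nil => simp [ih]
    | cons b bs => simp [ih]

theorem comps_sum {X M : Type*} [AddCommMonoid M] (t : List X) :
    ∀ (a : X) (Ψ : List (List X) → M),
      ((comps (a :: t)).map Ψ).sum =
        spl (fun u v => ((comps v).map fun c => Ψ ((a :: u) :: c)).sum) t := by
  induction t with
  | nil => intro a Ψ; simp [comps, spl]
  | cons a' t ih =>
    intro a Ψ
    rw [comps, List.map_append, List.sum_append, sum_filterMap_aux, ih, List.map_map]
    rfl

theorem fcomp_nil {B : Type*} [Ring B] (f h : List B → B) : fcomp f h [] = f [] := by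
  simp [fcomp, comps]

theorem fcomp_cons {B : Type*} [Ring B] (f h : List B → B) (a : B) (t : List B) :
    fcomp f h (a :: t) = spl (fun u v => fcomp (fun l => f (h (a :: u) :: l)) h v) t := by
  unfold fcomp
  rw [comps_sum]
  rfl

/-- Type of series, carrying the ring structure given by the formal product. -/
def Ser (B : Type*) := List B → B

instance {B : Type*} [Ring B] : AddCommGroup (Ser B) :=
  inferInstanceAs (AddCommGroup (List B → B))

section
variable {B : Type*} [Ring B]

theorem fcomp_add (f g h : List B → B) (l : List B) :
    fcomp (fun x => f x + g x) h l = fcomp f h l + fcomp g h l := by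
  simp [fcomp]

theorem fcomp_lmul (b : B) (g h : List B → B) (l : List B) :
    fcomp (fun x => b * g x) h l = b * fcomp g h l := by
  simp [fcomp, List.sum_map_mul_left]

theorem fcomp_zero (h : List B → B) (l : List B) : fcomp (fun _ => 0) h l = 0 := by
  simp [fcomp]

theorem fmul_nil (f g : List B → B) : fmul f g [] = f [] * g [] := by
  rw [fmul_eq_spl]; rfl

theorem fmul_cons (f g : List B → B) (a : B) (t : List B) :
    fmul f g (a :: t) = f [] * g (a :: t) + fmul (fun l => f (a :: l)) g t := by
  rw [fmul_eq_spl, fmul_eq_spl]; rfl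

theorem fmul_assoc (f g k : List B → B) : fmul (fmul f g) k = fmul f (fmul g k) := by
  funext l
  simp only [fmul_eq_spl]
  have h1 : ∀ u v, spl (fun u v => f u * g v) u * k v = spl (fun x y => f x * g y * k v) u :=
    fun u v => spl_hom (AddMonoidHom.mulRight (k v)) u (fun u v => f u * g v)
  have h2 : ∀ u v, f u * spl (fun u v => g u * k v) v = spl (fun y w => f u * g y * k w) v := by
    intro u v
    have := spl_hom (AddMonoidHom.mulLeft (f u)) v (fun u v => g u * k v)
    simpa [mul_assoc] using this
  simp only [h1, h2]
  exact spl_assoc l (fun x y v => f x * g y * k v)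

theorem one_fmul (f : List B → B) : fmul fmfsOne f = f := by
  funext l
  rw [fmul_eq_spl, spl_left]
  · simp [fmfsOne]
  · intro a u v; simp [fmfsOne]

theorem fmul_one (f : List B → B) : fmul f fmfsOne = f := by
  funext l
  rw [fmul_eq_spl, spl_right]
  · simp [fmfsOne]
  · intro a u v; simp [fmfsOne]

instance : Ring (Ser B) :=
  { (inferInstance : AddCommGroup (Ser B)) with
    mul := fun f g => fmul f g
    one := fmfsOne
    mul_assoc := fmul_assoc
    one_mul := one_fmul
    mul_one := fmul_one
    zero_mul := by
      intro f; funext l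
      change fmul (fun _ => 0) f l = 0
      simp [fmul]
    mul_zero := by
      intro f; funext l
      change fmul f (fun _ => 0) l = 0
      simp [fmul]
    left_distrib := by
      intro f g k; funext l
      change fmul f (fun x => g x + k x) l = fmul f g l + fmul f k l
      simp [fmul, mul_add, Finset.sum_add_distrib]
    right_distrib := by
      intro f g k; funext l
      change fmul (fun x => f x + g x) k l = fmul f k l + fmul g k l
      simp [fmul, add_mul, Finset.sum_add_distrib] }

theorem fcomp_one (h : List B → B) : fcomp fmfsOne h = fmfsOne := by
  funext l
  cases l with
  | nil => simp [fcomp_nil]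
  | cons a t => simp [fcomp_cons, fmfsOne, fcomp_zero, spl_zero]

theorem fcomp_mul_aux (h : List B → B) (n : ℕ) : ∀ (l : List B), l.length ≤ n →
    ∀ f g : List B → B, fcomp (fmul f g) h l = fmul (fcomp f h) (fcomp g h) l := by
  induction n with
  | zero =>
    intro l hl f g
    obtain rfl : l = [] := by simpa using hl
    simp [fcomp_nil, fmul_nil]
  | succ n ih =>
    intro l hl f g
    cases l with
    | nil => simp [fcomp_nil, fmul_nil]
    | cons a t =>
      have hl' : t.length ≤ n := by simpa using hl
      rw [fcomp_cons, fmul_cons, fcomp_nil]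
      simp only [fmul_cons, fcomp_add, fcomp_lmul, spl_add]
      congr 1
      · rw [fcomp_cons]
        exact (spl_hom (AddMonoidHom.mulLeft (f [])) t _).symm
      · have e : ∀ u v, u ++ v = t →
            fcomp (fun l => fmul (fun l => f (h (a :: u) :: l)) g l) h v =
            spl (fun y w => fcomp (fun l => f (h (a :: u) :: l)) h y * fcomp g h w) v := by
          intro u v huv
          rw [← fmul_eq_spl]
          refine ih v ?_ _ _
          rw [← huv] at hl'
          simp at hl'; omega
        rw [spl_congr t _ _ e, ← spl_assoc, fmul_eq_spl]
        apply spl_congr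
        intro u v _
        rw [fcomp_cons]
        exact (spl_hom (AddMonoidHom.mulRight (fcomp g h v)) u _).symm

theorem fcomp_mul (f g h : List B → B) :
    fcomp (fmul f g) h = fmul (fcomp f h) (fcomp g h) := by
  funext l; exact fcomp_mul_aux h _ l le_rfl f g

/-- Right composition as a ring homomorphism. -/
def compHom (h : Ser B) : Ser B →+* Ser B where
  toFun f := fcomp f h
  map_one' := fcomp_one h
  map_mul' f g := fcomp_mul f g h
  map_zero' := by funext l; exact fcomp_zero h l
  map_add' f g := by funext l; exact fcomp_add f g h l

theorem fcomp_I (h : List B → B) (h0 : h [] = 0) : fcomp fmfsI h = h := by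
  funext l
  cases l with
  | nil => simp [fcomp_nil, fmfsI, h0]
  | cons a t =>
    have e : ∀ x : B, (fun l => fmfsI (x :: l)) = fun l => x * fmfsOne l := by
      intro x; funext l; cases l <;> simp [fmfsI, fmfsOne]
    rw [fcomp_cons]
    simp only [e, fcomp_lmul, fcomp_one]
    rw [spl_right]
    · simp [fmfsOne]
    · intro u b v; simp [fmfsOne]

/-- Agreement on lists of length less than `n`. -/
def Agr (n : ℕ) (f g : List B → B) : Prop := ∀ l, l.length < n → f l = g l

theorem Agr.mul {n : ℕ} {f g h k : List B → B} (h1 : Agr n f g) (h2 : Agr n h k) :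
    Agr n (fmul f h) (fmul g k) := by
  intro l hl
  rw [fmul_eq_spl, fmul_eq_spl]
  apply spl_congr
  rintro u v rfl
  simp at hl
  rw [h1 u (by omega), h2 v (by omega)]

theorem Agr.mul_succ {n : ℕ} {f g h k : List B → B} (h1 : Agr n f g) (h2 : Agr n h k)
    (f0 : f [] = 0) (g0 : g [] = 0) (h0 : h [] = 0) (k0 : k [] = 0) :
    Agr (n + 1) (fmul f h) (fmul g k) := by
  intro l hl
  rw [fmul_eq_spl, fmul_eq_spl]
  apply spl_congr
  rintro u v rfl
  simp at hl
  rcases u with _ | ⟨a, u⟩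
  · simp [f0, g0]
  rcases v with _ | ⟨b, v⟩
  · simp [h0, k0]
  simp at hl
  rw [h1 (a :: u) (by simp; omega), h2 (b :: v) (by simp; omega)]

theorem Agr.comp {n : ℕ} {h k : List B → B} (h1 : Agr n h k) (f : List B → B) :
    Agr n (fcomp f h) (fcomp f k) := by
  intro l
  induction hm : l.length using Nat.strong_induction_on generalizing l f with
  | _ m ih =>
    intro hl
    cases l with
    | nil => simp [fcomp_nil]
    | cons a t =>
      rw [fcomp_cons, fcomp_cons]
      apply spl_congr
      rintro u v rfl
      simp at hm
      rw [h1 (a :: u) (by simp; omega)]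
      exact ih v.length (by omega) _ v rfl (by omega)

end

section
variable {K : Type*} [Field K] {B : Type*} [Ring B] [Algebra K B]

theorem IsMulSeries.D {f : List B → B} (hf : IsMulSeries K f) (a : B) :
    IsMulSeries K (fun l => f (a :: l)) := fun p s c x y => hf (a :: p) s c x y

theorem IsMulSeries.head_zero {f : List B → B} (hf : IsMulSeries K f) (s : List B) :
    f (0 :: s) = 0 := by
  have := hf [] s 1 0 0
  simpa using this

theorem IsMulSeries.head {f : List B → B} (hf : IsMulSeries K f) (c : K) (x y : B) (s : List B) :
    f ((c • x + y) :: s) = c • f (x :: s) + f (y :: s) := hf [] s c x y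

theorem IsMulSeries.head_add {f : List B → B} (hf : IsMulSeries K f) (x y : B) (s : List B) :
    f ((x + y) :: s) = f (x :: s) + f (y :: s) := by
  simpa using hf [] s 1 x y

theorem spl_smul_add {X : Type*} (c : K) (t : List X) (φ ψ : List X → List X → B) :
    spl (fun u v => c • φ u v + ψ u v) t = c • spl φ t + spl ψ t := by
  rw [spl_add]
  congr 1
  exact (spl_hom (DistribSMul.toAddMonoidHom B c) t φ).symm

theorem spl_linear (c : K) (x y : B) (s : List B) (p : List B) :
    ∀ (φ : List B → List B → B)
      (_ : ∀ q s' v, φ (q ++ (c • x + y) :: s') v = c • φ (q ++ x :: s') v + φ (q ++ y :: s') v)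
      (_ : ∀ u q, q.length ≤ p.length →
        φ u (q ++ (c • x + y) :: s) = c • φ u (q ++ x :: s) + φ u (q ++ y :: s)),
      spl φ (p ++ (c • x + y) :: s) = c • spl φ (p ++ x :: s) + spl φ (p ++ y :: s) := by
  induction p with
  | nil =>
    intro φ h1 h2
    have h3 := h2 [] [] le_rfl
    simp only [List.nil_append] at h3
    have h4 : (fun u v => φ ((c • x + y) :: u) v) =
        fun u v => c • φ (x :: u) v + φ (y :: u) v := by
      funext u v; exact h1 [] u v
    simp only [List.nil_append, spl]
    rw [h3, h4, spl_smul_add, smul_add]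
    abel
  | cons a p ih =>
    intro φ h1 h2
    simp only [List.cons_append, spl]
    have h3 := h2 [] (a :: p) le_rfl
    simp only [List.cons_append] at h3
    rw [h3, ih (fun u v => φ (a :: u) v) (fun q s' v => h1 (a :: q) s' v)
      (fun u q hq => h2 _ _ (by simp; omega)), smul_add]
    abel

theorem IsMulSeries.mul {f g : List B → B} (hf : IsMulSeries K f) (hg : IsMulSeries K g) :
    IsMulSeries K (fmul f g) := by
  intro p s c x y
  simp only [fmul_eq_spl]
  apply spl_linear
  · intro q s' v; simp [hf q s' c x y, add_mul]
  · intro u q _; simp [hg q s c x y, mul_add]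

theorem fcomp_smul_add (c : K) (f g h : List B → B) (l : List B) :
    fcomp (fun x => c • f x + g x) h l = c • fcomp f h l + fcomp g h l := by
  rw [fcomp_add]
  congr 1
  simp only [fcomp]
  induction comps l with
  | nil => simp
  | cons a L ih => simp [ih, smul_add]

theorem IsMulSeries.comp {f h : List B → B} (hf : IsMulSeries K f) (hh : IsMulSeries K h) :
    IsMulSeries K (fcomp f h) := by
  intro p
  induction hm : p.length using Nat.strong_induction_on generalizing p f with
  | _ m ih =>
    intro s c x y
    cases p with
    | nil =>
      simp only [List.nil_append, fcomp_cons]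
      rw [← spl_smul_add]
      apply spl_congr
      intro u v _
      rw [← fcomp_smul_add]
      congr 1
      funext l
      rw [hh.head, hf.head]
    | cons a p =>
      simp only [List.cons_append, fcomp_cons]
      apply spl_linear
      · intro q s' v
        rw [← fcomp_smul_add]
        congr 1
        funext l
        have := hh (a :: q) s' c x y
        simp only [List.cons_append] at this
        rw [this, hf.head]
      · intro u q hq
        simp at hm
        exact ih q.length (by omega) (hf.D _) q rfl s c x y

theorem IsMulSeries.add {f g : List B → B} (hf : IsMulSeries K f) (hg : IsMulSeries K g) :
    IsMulSeries K (fun l => f l + g l) := by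
  intro p s c x y
  simp only [hf p s c x y, hg p s c x y, smul_add]; abel

theorem IsMulSeries.sub {f g : List B → B} (hf : IsMulSeries K f) (hg : IsMulSeries K g) :
    IsMulSeries K (fun l => f l - g l) := by
  intro p s c x y
  simp only [hf p s c x y, hg p s c x y, smul_sub]; abel

theorem isMulSeries_zero : IsMulSeries K (fun _ : List B => (0 : B)) := by
  intro p s c x y; simp

theorem isMulSeries_one : IsMulSeries K (fmfsOne : List B → B) := by
  intro p s c x y; cases p <;> simp [fmfsOne]

theorem isMulSeries_I : IsMulSeries K (fmfsI : List B → B) := by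
  intro p s c x y
  rcases p with _ | ⟨a, _ | ⟨b, p⟩⟩ <;> cases s <;> simp [fmfsI]

theorem fcomp_I_right {f : List B → B} (hf : IsMulSeries K f) : fcomp f fmfsI = f := by
  funext l
  induction hm : l.length using Nat.strong_induction_on generalizing l f with
  | _ m ih =>
    cases l with
    | nil => simp [fcomp_nil]
    | cons a t =>
      rw [fcomp_cons]
      have e : spl (fun u v => fcomp (fun l => f (fmfsI (a :: u) :: l)) fmfsI v) t =
          spl (fun u v => f (fmfsI (a :: u) :: v)) t := by
        apply spl_congr
        rintro u v rfl
        simp at hm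
        exact ih v.length (by omega) (hf.D _) v rfl
      rw [e, spl_left]
      · simp [fmfsI]
      · intro b u v; simp [fmfsI, hf.head_zero]

/-- Composition in which the first inner series is replaced by `k`. -/
def Mc (f k g : List B → B) : List B → B :=
  fun w => spl (fun u v => fcomp (fun l => f (k u :: l)) g v) w

theorem fcomp_cons' (f g : List B → B) (a : B) (t : List B) :
    fcomp f g (a :: t) = Mc f (fun l => g (a :: l)) g t := fcomp_cons f g a t

theorem Mc_cons (f k g : List B → B) (a : B) (t : List B) :
    Mc f k g (a :: t) = Mc (fun l => f (k [] :: l)) (fun l => g (a :: l)) g t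
      + Mc f (fun l => k (a :: l)) g t := by
  rw [← fcomp_cons']; rfl

theorem Mc_spl {f : List B → B} (hf : IsMulSeries K f) (ψ : List B → List B → B)
    (G : List B → B) (t : List B) :
    Mc f (fun u => spl ψ u) G t = spl (fun x w => Mc f (ψ x) G w) t := by
  unfold Mc
  rw [← spl_assoc t (fun x y v => fcomp (fun l => f (ψ x y :: l)) G v)]
  apply spl_congr
  intro u v _
  let L : B →+ B :=
    { toFun := fun b => fcomp (fun l => f (b :: l)) G v
      map_zero' := by simp only [hf.head_zero, fcomp_zero]
      map_add' := by intro b b'; simp only [hf.head_add, fcomp_add] }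
  exact spl_hom L u ψ

theorem Mc_comp (g h : List B → B) (n : ℕ) : ∀ (l : List B), l.length ≤ n →
    ∀ f k : List B → B, IsMulSeries K f →
      fcomp (Mc f k g) h l = Mc f (fcomp k h) (fcomp g h) l := by
  have base : ∀ f k : List B → B, fcomp (Mc f k g) h [] = Mc f (fcomp k h) (fcomp g h) [] := by
    intro f k
    simp [fcomp_nil, Mc, spl]
  induction n with
  | zero =>
    intro l hl f k hf
    obtain rfl : l = [] := by simpa using hl
    exact base f k
  | succ n ih =>
    intro l hl f k hf
    cases l with
    | nil => exact base f k
    | cons a t =>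
      have hl' : t.length ≤ n := by simpa using hl
      have e : ∀ k : List B → B, (fun l => fcomp k h (a :: l)) =
          fun l => spl (fun u v => fcomp (fun l => k (h (a :: u) :: l)) h v) l := by
        intro k; funext l; exact fcomp_cons k h a l
      rw [fcomp_cons, Mc_cons, fcomp_nil, e, e, Mc_spl (hf.D _), Mc_spl hf, ← spl_add]
      apply spl_congr
      rintro u v rfl
      simp at hl'
      simp only [Mc_cons, fcomp_add]
      rw [ih v (by omega) _ _ (hf.D _), ih v (by omega) _ _ hf]

theorem fcomp_assoc {f : List B → B} (hf : IsMulSeries K f) (g h : List B → B) :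
    fcomp (fcomp f g) h = fcomp f (fcomp g h) := by
  funext l
  cases l with
  | nil => simp [fcomp_nil]
  | cons a t =>
    have e : (fun l => fcomp g h (a :: l)) =
        fun l => spl (fun u v => fcomp (fun l => g (h (a :: u) :: l)) h v) l := by
      funext l; exact fcomp_cons g h a l
    rw [fcomp_cons, fcomp_cons', e, Mc_spl hf]
    apply spl_congr
    intro u v _
    have e2 : (fun l => fcomp f g (h (a :: u) :: l)) = Mc f (fun l => g (h (a :: u) :: l)) g := by
      funext l; exact fcomp_cons' f g _ l
    rw [e2]
    exact Mc_comp g h _ v le_rfl _ _ hf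

theorem exists_fix (c : B) (Φ : (List B → B) → (List B → B)) (f0 : List B → B)
    (hf0 : IsMulSeries K f0 ∧ f0 [] = c)
    (hΦ : ∀ f, IsMulSeries K f ∧ f [] = c → IsMulSeries K (Φ f) ∧ Φ f [] = c)
    (hc : ∀ n f g, f [] = c → g [] = c → Agr n f g → Agr (n + 1) (Φ f) (Φ g)) :
    ∃ f, IsMulSeries K f ∧ f [] = c ∧ Φ f = f := by
  have hP : ∀ n, IsMulSeries K (Φ^[n] f0) ∧ (Φ^[n] f0) [] = c := by
    intro n
    induction n with
    | zero => exact hf0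
    | succ n ih => rw [Function.iterate_succ_apply']; exact hΦ _ ih
  have h1 : ∀ n, Agr n (Φ^[n] f0) (Φ^[n + 1] f0) := by
    intro n
    induction n with
    | zero => intro l hl; simp at hl
    | succ n ih =>
      rw [Function.iterate_succ_apply', Function.iterate_succ_apply' Φ (n + 1)]
      exact hc _ _ _ (hP _).2 (hP _).2 ih
  have h2 : ∀ n k, Agr n (Φ^[n] f0) (Φ^[n + k] f0) := by
    intro n k
    induction k with
    | zero => intro l _; rfl
    | succ k ih =>
      intro l hl
      rw [ih l hl]
      exact h1 (n + k) l (by omega)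
  let F : List B → B := fun l => (Φ^[l.length + 1] f0) l
  have hF : ∀ n, Agr n F (Φ^[n] f0) := by
    intro n l hl
    obtain ⟨k, rfl⟩ := Nat.exists_eq_add_of_le (Nat.succ_le_of_lt hl)
    exact h2 (l.length + 1) k l (by omega)
  have F0 : F [] = c := (hP 1).2
  refine ⟨F, ?_, F0, ?_⟩
  · intro p s c x y
    have := (hP (p.length + (s.length + 1) + 1)).1 p s c x y
    simpa [F] using this
  · funext l
    have a1 := hc _ _ _ F0 (hP _).2 (hF l.length) l (by omega)
    rw [a1, ← Function.iterate_succ_apply' Φ]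

theorem fix_unique (A β f g : List B → B) (f0 : f [] = 0) (g0 : g [] = 0)
    (hf : ∀ l, f l = A l - fmul f (fmul (fcomp β f) f) l)
    (hg : ∀ l, g l = A l - fmul g (fmul (fcomp β g) g) l) : f = g := by
  have : ∀ n, Agr n f g := by
    intro n
    induction n with
    | zero => intro l hl; simp at hl
    | succ n ih =>
      intro l hl
      rw [hf, hg, (ih.mul_succ ((ih.comp β).mul ih) f0 g0 (by simp [fmul_nil, f0])
        (by simp [fmul_nil, g0])) l hl]
  funext l
  exact this (l.length + 1) l (by omega)

theorem I_mul_cancel {f g : List B → B} (h : fmul fmfsI f = fmul fmfsI g) : f = g := by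
  have e : ∀ f : List B → B, ∀ l, fmul fmfsI f (1 :: l) = f l := by
    intro f l
    rw [fmul_cons, fmul_eq_spl, spl_left]
    · simp [fmfsI]
    · intro a u v; simp [fmfsI]
  funext l
  rw [← e f, h, e g]

theorem spl_concat {X M : Type*} [AddCommMonoid M] (b : X) (t : List X) :
    ∀ φ : List X → List X → M,
      spl φ (t ++ [b]) = spl (fun u v => φ u (v ++ [b])) t + φ (t ++ [b]) [] := by
  induction t with
  | nil => intro φ; simp [spl]
  | cons a t ih => intro φ; simp [spl, ih, add_assoc]

theorem mul_cancel_right {f g ρ : List B → B} (ρ0 : ρ [] = 0) (ρ1 : ρ [1] = 1)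
    (h : fmul f ρ = fmul g ρ) : f = g := by
  have : ∀ n, Agr n f g := by
    intro n
    induction n with
    | zero => intro l hl; simp at hl
    | succ n ih =>
      intro l hl
      have e := congrFun h (l ++ [1])
      simp only [fmul_eq_spl, spl_concat, ρ0, mul_zero, add_zero] at e
      rcases List.eq_nil_or_concat l with rfl | ⟨t, b, rfl⟩
      · simpa [spl, ρ1] using e
      · rw [List.concat_eq_append] at *
        simp only [spl_concat, List.nil_append, ρ1, mul_one] at e
        have e2 : spl (fun u v => f u * ρ (v ++ [b] ++ [1])) t =
            spl (fun u v => g u * ρ (v ++ [b] ++ [1])) t := by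
          apply spl_congr
          rintro u v rfl
          simp at hl
          rw [ih u (by omega)]
        rw [e2] at e
        exact add_left_cancel e
  funext l
  exact this (l.length + 1) l (by omega)

end

variable {K : Type*} [Field K] {B : Type*} [Ring B] [Algebra K B]

/-- Let `β ∈ Mul[[B]]` and `α = I + IβI`.  Then `α` has a compositional inverse
`α°⁻¹`, and there is a unique `γ ∈ Mul[[B]]` with `α°⁻¹ = (1 + Iγ)⁻¹ I`
(equivalently, since `1 + Iγ` is invertible, `(1 + Iγ) α°⁻¹ = I`); moreover this
`γ` equals `((1 + βI)⁻¹ β) ∘ α°⁻¹`. -/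
theorem rtransform_characterization (β : List B → B) (hβ : IsMulSeries K β) :
    ∃ αinv : List B → B, IsMulSeries K αinv ∧ αinv [] = 0 ∧
      fcomp (fun l => fmfsI l + fmul (fmul fmfsI β) fmfsI l) αinv = fmfsI ∧
      fcomp αinv (fun l => fmfsI l + fmul (fmul fmfsI β) fmfsI l) = fmfsI ∧
      (∃! γ : {g : List B → B // IsMulSeries K g},
        fmul (fun l => fmfsOne l + fmul fmfsI γ.1 l) αinv = fmfsI) ∧
      (∀ γ δ : List B → B, IsMulSeries K γ → IsMulSeries K δ →
        fmul (fun l => fmfsOne l + fmul fmfsI γ l) αinv = fmfsI →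
        fmul (fun l => fmfsOne l + fmul β fmfsI l) δ = fmfsOne →
        fmul δ (fun l => fmfsOne l + fmul β fmfsI l) = fmfsOne →
        γ = fcomp (fmul δ β) αinv) := by
  have hI0 : (fmfsI : List B → B) [] = 0 := rfl
  -- the compositional inverse
  obtain ⟨ρ, hρ, ρ0, ρfix⟩ := exists_fix (K := K) (0 : B)
    (fun f l => fmfsI l - fmul f (fmul (fcomp β f) f) l) (fun _ => 0)
    ⟨isMulSeries_zero, rfl⟩
    (by
      rintro f ⟨hf, f0⟩
      exact ⟨isMulSeries_I.sub (hf.mul ((hβ.comp hf).mul hf)), by simp [fmul_nil, f0, hI0]⟩)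
    (by
      intro n f g f0 g0 h l hl
      simp only
      rw [(h.mul_succ ((h.comp β).mul h) f0 g0 (by simp [fmul_nil, f0])
        (by simp [fmul_nil, g0])) l hl])
  obtain ⟨δ₀, hδ₀, -, δfix⟩ := exists_fix (K := K) (1 : B)
    (fun f l => fmfsOne l - fmul (fmul β fmfsI) f l) fmfsOne
    ⟨isMulSeries_one, rfl⟩
    (by
      rintro f ⟨hf, f0⟩
      exact ⟨isMulSeries_one.sub ((hβ.mul isMulSeries_I).mul hf),
        by simp [fmul_nil, hI0, fmfsOne]⟩)
    (by
      intro n f g f0 g0 h l hl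
      simp only
      congr 1
      rw [fmul_eq_spl, fmul_eq_spl]
      apply spl_congr
      rintro u v rfl
      rcases u with _ | ⟨a, u⟩
      · simp [fmul_nil, hI0]
      · simp at hl
        rw [h v (by omega)])
  have ρ1 : ρ [1] = 1 := by
    have := congrFun ρfix [1]
    simp only [fmul_cons, fmul_nil, ρ0] at this
    simpa [fmfsI] using this.symm
  let I' : Ser B := fmfsI
  let b : Ser B := β
  let r : Ser B := ρ
  let al : Ser B := I' + I' * b * I'
  have hal : (fun l => fmfsI l + fmul (fmul fmfsI β) fmfsI l) = al := rfl
  have al0 : al [] = 0 := by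
    change fmfsI [] + fmul (fmul fmfsI β) fmfsI [] = (0 : B)
    simp [fmul_nil, hI0]
  have hr : r = I' - r * (compHom r b * r) := ρfix.symm
  have cI : ∀ h : Ser B, h [] = 0 → compHom h I' = h := fun h h0 => fcomp_I h h0
  -- key identity for γ
  have key : ∀ δ : List B → B, fmul (fun l => fmfsOne l + fmul β fmfsI l) δ = fmfsOne →
      fmul (fun l => fmfsOne l + fmul fmfsI (fcomp (fmul δ β) ρ) l) ρ = fmfsI := by
    intro δ hδ
    let d : Ser B := δ
    have hd : (1 + b * I') * d = 1 := hδ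
    have hd2 : (1 + compHom r b * r) * compHom r d = 1 := by
      have := congrArg (compHom r) hd
      rwa [map_mul, map_add, map_mul, map_one, cI r ρ0] at this
    change (1 + I' * compHom r (d * b)) * r = I'
    have h3 : r * (1 + compHom r b * r) = I' := by
      rw [mul_add, mul_one]
      nth_rewrite 1 [hr]
      abel
    have h4 : I' * compHom r d = r := by
      rw [← h3, mul_assoc, hd2, mul_one]
    rw [map_mul, ← mul_assoc, h4, ← h3]
    noncomm_ring
  have uniq : ∀ γ γ' : List B → B,
      fmul (fun l => fmfsOne l + fmul fmfsI γ l) ρ = fmfsI →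
      fmul (fun l => fmfsOne l + fmul fmfsI γ' l) ρ = fmfsI → γ = γ' := by
    intro γ γ' h h'
    have h1 := mul_cancel_right ρ0 ρ1 (h.trans h'.symm)
    apply I_mul_cancel
    funext l
    exact add_left_cancel (congrFun h1 l)
  have hδ₀' : fmul (fun l => fmfsOne l + fmul β fmfsI l) δ₀ = fmfsOne := by
    let d : Ser B := δ₀
    have hd : 1 - b * I' * d = d := δfix
    change (1 + b * I') * d = 1
    rw [add_mul, one_mul]
    nth_rewrite 1 [← hd]
    abel
  refine ⟨ρ, hρ, ρ0, ?_, ?_, ?_, ?_⟩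
  · change compHom r (I' + I' * b * I') = I'
    rw [map_add, map_mul, map_mul, cI r ρ0, mul_assoc]
    nth_rewrite 1 [hr]
    abel
  · rw [hal]
    change compHom al r = I'
    have hχ : compHom al r = al - compHom al r * (compHom (compHom al r) b * compHom al r) := by
      have h1 := congrArg (compHom al) hr
      rw [map_sub, map_mul, map_mul, cI al al0] at h1
      have h2 : compHom al (compHom r b) = compHom (compHom al r) b := fcomp_assoc hβ ρ al
      rwa [h2] at h1
    have hI : I' = al - I' * (compHom I' b * I') := by
      have h2 : compHom I' b = b := fcomp_I_right hβ
      rw [h2]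
      change I' = I' + I' * b * I' - _
      rw [mul_assoc]; abel
    refine fix_unique al β _ _ ?_ hI0 (fun l => congrFun hχ l) (fun l => congrFun hI l)
    exact (fcomp_nil ρ al).trans ρ0
  · refine ⟨⟨fcomp (fmul δ₀ β) ρ, (hδ₀.mul hβ).comp hρ⟩, key δ₀ hδ₀', ?_⟩
    rintro ⟨γ, hγ⟩ h
    exact Subtype.ext (uniq _ _ h (key δ₀ hδ₀'))
  · intro γ δ _ _ h h1 _
    exact uniq _ _ h (key δ h1)
end
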